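/- Let τ > 0 and let x = ∑_{ℓ=1}^{L} x_ℓ, where each x_ℓ lies in the linear span of the Haar system and the Haar supports {I ∈ 𝒟 : ⟨x_ℓ, h_I⟩ ≠ 0} are pairwise disjoint for distinct ℓ. If ‖x_ℓ‖_{H¹} ≥ τ ‖x‖_{H¹} > 0 for every 1 ≤ ℓ ≤ L, then L ≤ 16 τ^{−2}. -/

import Mathlib

open MeasureTheory
open scoped ENNReal

noncomputable section

namespace DyadicH

/-- The index `q = (n, k)` encodes the dyadic interval `[k/2^n, (k+1)/2^n)`; it is a genuine
dyadic subinterval of `[0,1)` iff `k < 2^n`. -/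
def IsDyadic (q : ℕ × ℕ) : Prop := q.2 < 2 ^ q.1

/-- The dyadic interval `[k/2^n, (k+1)/2^n)` associated to the index `q = (n, k)`. -/
def dint (q : ℕ × ℕ) : Set ℝ := Set.Ico ((q.2 : ℝ) / 2 ^ q.1) ((q.2 + 1 : ℝ) / 2 ^ q.1)

/-- The length `|I| = 2^{-n}` of the dyadic interval indexed by `q = (n, k)`. -/
def len (q : ℕ × ℕ) : ℝ := ((2 : ℝ) ^ q.1)⁻¹

/-- The `L^∞`-normalized Haar function `h_I`: `+1` on the left half of `I`, `-1` on the right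
half of `I`, `0` outside `I`. -/
def haarFn (q : ℕ × ℕ) : ℝ → ℝ :=
  (Set.Ico ((q.2 : ℝ) / 2 ^ q.1) ((2 * q.2 + 1 : ℝ) / 2 ^ (q.1 + 1))).indicator
      (fun _ => (1 : ℝ))
    - (Set.Ico ((2 * q.2 + 1 : ℝ) / 2 ^ (q.1 + 1)) ((q.2 + 1 : ℝ) / 2 ^ q.1)).indicator
      (fun _ => (1 : ℝ))

/-- The `L²` inner product on `[0,1)`. -/
def ip (f g : ℝ → ℝ) : ℝ := ∫ t in Set.Ico (0 : ℝ) 1, f t * g t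

/-- The Haar coefficient `⟨f, h_I⟩`. -/
def haarCoeff (f : ℝ → ℝ) (q : ℕ × ℕ) : ℝ := ip f (haarFn q)

/-- The type of (indices of) dyadic intervals. -/
def Didx : Type := {q : ℕ × ℕ // IsDyadic q}

/-- The dyadic square function `S(f) = (∑_{I ∈ 𝒟} ⟨f, h_I/|I|⟩² 1_I)^{1/2}`. -/
def sqFn (f : ℝ → ℝ) : ℝ → ℝ := fun t =>
  Real.sqrt (∑' q : Didx,
    (haarCoeff f q.1 * 2 ^ q.1.1) ^ 2 * (dint q.1).indicator (fun _ => (1 : ℝ)) t)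

/-- The dyadic `H¹` norm `‖f‖_{H¹} = ‖S(f)‖_{L¹}`. -/
def H1norm (f : ℝ → ℝ) : ℝ := ∫ t in Set.Ico (0 : ℝ) 1, sqFn f t

/-- The linear span of the Haar system `{h_I : I ∈ 𝒟}`. -/
def haarSpan : Submodule ℝ (ℝ → ℝ) := Submodule.span ℝ (haarFn '' {q | IsDyadic q})

/-- The linear span of `{h_I : I ∈ 𝒟_N}`. -/
def haarSpanLe (N : ℕ) : Submodule ℝ (ℝ → ℝ) :=
  Submodule.span ℝ (haarFn '' {q | IsDyadic q ∧ q.1 ≤ N})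

/-- `𝒟_m = {I ∈ 𝒟 : |I| ≥ 2^{-m}}` as a finite set of indices. -/
def dFinset (m : ℕ) : Finset (ℕ × ℕ) :=
  (Finset.range (m + 1)).biUnion fun n => (Finset.range (2 ^ n)).image fun k => (n, k)

open scoped Classical in
/-- The Carleson constant `⟦G⟧ = sup_{I ∈ G} |I|⁻¹ ∑_{J ∈ G, J ⊆ I} |J|` of a finite
collection of dyadic intervals. -/
def carleson (G : Finset (ℕ × ℕ)) : ℝ :=
  ⨆ I ∈ G, ((2 : ℝ) ^ I.1 * ∑ J ∈ G, if dint J ⊆ dint I then len J else 0)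

end DyadicH

namespace DyadicH

lemma mem_dint_iff_of_mem_dint {p q : ℕ × ℕ} (hpq : p.1 ≤ q.1) {t : ℝ} (ht : t ∈ dint q) :
    t ∈ dint p ↔ p.2 * 2 ^ (q.1 - p.1) ≤ q.2 ∧ q.2 < (p.2 + 1) * 2 ^ (q.1 - p.1) := by
  obtain ⟨m, j⟩ := p
  obtain ⟨n, k⟩ := q
  obtain ⟨d, rfl⟩ := Nat.exists_eq_add_of_le hpq
  simp only [dint, Set.mem_Ico, Nat.add_sub_cancel_left] at ht ⊢
  have hm : (0 : ℝ) < 2 ^ m := by positivity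
  have hd : (0 : ℝ) < 2 ^ d := by positivity
  rw [div_le_iff₀ (by positivity), lt_div_iff₀ (by positivity), pow_add] at ht
  rw [div_le_iff₀ hm, lt_div_iff₀ hm, ← mul_le_mul_iff_left₀ hd, ← mul_lt_mul_iff_left₀ hd,
    mul_assoc]
  refine and_congr ⟨fun h => ?_, fun h => ?_⟩ ⟨fun h => ?_, fun h => ?_⟩
  · have : (j * 2 ^ d : ℝ) < k + 1 := h.trans_lt ht.2
    exact Nat.lt_succ_iff.1 (by exact_mod_cast this)
  · exact le_trans (by exact_mod_cast h) ht.1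
  · have : (k : ℝ) < (j + 1) * 2 ^ d := ht.1.trans_lt h
    exact_mod_cast this
  · exact ht.2.trans_le (by exact_mod_cast Nat.succ_le_of_lt h)

lemma haarFn_eq_indicator_sub (q : ℕ × ℕ) :
    haarFn q = (dint (q.1 + 1, 2 * q.2)).indicator (fun _ => (1 : ℝ))
      - (dint (q.1 + 1, 2 * q.2 + 1)).indicator (fun _ => (1 : ℝ)) := by
  have h₁ : ((2 * q.2 : ℕ) : ℝ) / 2 ^ (q.1 + 1) = q.2 / 2 ^ q.1 := by
    push_cast; field_simp; ring
  have h₂ : (((2 * q.2 + 1 : ℕ) : ℝ) + 1) / 2 ^ (q.1 + 1) = (q.2 + 1) / 2 ^ q.1 := by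
    push_cast; field_simp; ring
  simp only [haarFn, dint, h₁, h₂]
  push_cast
  rfl

lemma measurableSet_dint (q : ℕ × ℕ) : MeasurableSet (dint q) := measurableSet_Ico

lemma measurable_haarFn (q : ℕ × ℕ) : Measurable (haarFn q) := by
  rw [haarFn_eq_indicator_sub]
  exact (measurable_const.indicator (measurableSet_dint _)).sub
    (measurable_const.indicator (measurableSet_dint _))

lemma abs_haarFn_le (q : ℕ × ℕ) (t : ℝ) : |haarFn q t| ≤ 1 := by
  classical
  rw [haarFn_eq_indicator_sub, Pi.sub_apply, Set.indicator_apply, Set.indicator_apply]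
  split_ifs <;> norm_num

lemma dint_succ_subset {q : ℕ × ℕ} {j : ℕ} (hj : j = 2 * q.2 ∨ j = 2 * q.2 + 1) :
    dint (q.1 + 1, j) ⊆ dint q := fun t ht => by
  rw [mem_dint_iff_of_mem_dint (Nat.le_succ _) ht]
  simp only [Nat.add_sub_cancel_left]
  omega

lemma haarFn_eq_zero_of_notMem {q : ℕ × ℕ} {t : ℝ} (ht : t ∉ dint q) : haarFn q t = 0 := by
  rw [haarFn_eq_indicator_sub, Pi.sub_apply,
    Set.indicator_of_notMem (fun h => ht (dint_succ_subset (.inl rfl) h)),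
    Set.indicator_of_notMem (fun h => ht (dint_succ_subset (.inr rfl) h)), sub_zero]

lemma dint_subset_unitInterval {q : ℕ × ℕ} (hq : IsDyadic q) : dint q ⊆ Set.Ico 0 1 := by
  refine Set.Ico_subset_Ico (by positivity) ?_
  rw [div_le_one (by positivity)]
  exact_mod_cast Nat.succ_le_of_lt hq

lemma volume_real_dint (q : ℕ × ℕ) : volume.real (dint q) = len q := by
  rw [dint, Real.volume_real_Ico_of_le (by gcongr; linarith), len]
  field_simp
  ring

lemma setIntegral_indicator_dint {q : ℕ × ℕ} {s : Set ℝ} (hs : dint q ⊆ s) :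
    ∫ t in s, (dint q).indicator (fun _ => (1 : ℝ)) t = len q := by
  rw [setIntegral_indicator (measurableSet_dint q), Set.inter_eq_right.2 hs,
    setIntegral_const, volume_real_dint, smul_eq_mul, mul_one]

lemma integrable_indicator_dint (q : ℕ × ℕ) :
    Integrable ((dint q).indicator fun _ => (1 : ℝ)) :=
  (integrableOn_const (by simp [dint])).integrable_indicator (measurableSet_dint q)

lemma setIntegral_haarFn {q : ℕ × ℕ} (hq : IsDyadic q) :
    ∫ t in Set.Ico (0 : ℝ) 1, haarFn q t = 0 := by
  have hsub := dint_subset_unitInterval hq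
  simp only [haarFn_eq_indicator_sub, Pi.sub_apply]
  rw [integral_sub (integrable_indicator_dint _).integrableOn
      (integrable_indicator_dint _).integrableOn,
    setIntegral_indicator_dint ((dint_succ_subset (.inl rfl)).trans hsub),
    setIntegral_indicator_dint ((dint_succ_subset (.inr rfl)).trans hsub)]
  simp [len]

lemma haarFn_eq_of_mem_dint {p q : ℕ × ℕ} (hpq : p.1 < q.1) {s t : ℝ} (hs : s ∈ dint q)
    (ht : t ∈ dint q) : haarFn p s = haarFn p t := by
  classical
  have h (j : ℕ) : s ∈ dint (p.1 + 1, j) ↔ t ∈ dint (p.1 + 1, j) := by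
    rw [mem_dint_iff_of_mem_dint (p := (p.1 + 1, j)) hpq hs,
      mem_dint_iff_of_mem_dint (p := (p.1 + 1, j)) hpq ht]
  simp only [haarFn_eq_indicator_sub, Pi.sub_apply, Set.indicator_apply, h]

lemma haarCoeff_haarFn_of_lt {p q : ℕ × ℕ} (hq : IsDyadic q) (hpq : p.1 < q.1) :
    haarCoeff (haarFn p) q = 0 := by
  have hmem : (q.2 : ℝ) / 2 ^ q.1 ∈ dint q := ⟨le_rfl, by gcongr; linarith⟩
  have h (t : ℝ) : haarFn p t * haarFn q t = haarFn p (q.2 / 2 ^ q.1) * haarFn q t := by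
    by_cases ht : t ∈ dint q
    · rw [haarFn_eq_of_mem_dint hpq ht hmem]
    · simp [haarFn_eq_zero_of_notMem ht]
  simp only [haarCoeff, ip, h]
  rw [integral_const_mul, setIntegral_haarFn hq, mul_zero]

lemma measurable_and_bounded_of_mem_haarSpan {f : ℝ → ℝ} (hf : f ∈ haarSpan) :
    Measurable f ∧ ∃ C, ∀ t, |f t| ≤ C := by
  induction hf using Submodule.span_induction with
  | mem f hf =>
    obtain ⟨q, -, rfl⟩ := hf
    exact ⟨measurable_haarFn q, 1, abs_haarFn_le q⟩
  | zero => exact ⟨measurable_zero, 0, by simp⟩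
  | add f g _ _ hf hg =>
    obtain ⟨hf, C, hC⟩ := hf
    obtain ⟨hg, D, hD⟩ := hg
    exact ⟨hf.add hg, C + D, fun t => (abs_add_le _ _).trans (add_le_add (hC t) (hD t))⟩
  | smul a f _ hf =>
    obtain ⟨hf, C, hC⟩ := hf
    refine ⟨hf.const_smul a, |a| * C, fun t => ?_⟩
    rw [Pi.smul_apply, smul_eq_mul, abs_mul]
    gcongr
    exact hC t

lemma integrableOn_mul_haarFn {f : ℝ → ℝ} (hf : f ∈ haarSpan) (q : ℕ × ℕ) :
    IntegrableOn (fun t => f t * haarFn q t) (Set.Ico 0 1) := by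
  obtain ⟨hm, C, hC⟩ := measurable_and_bounded_of_mem_haarSpan hf
  refine Measure.integrableOn_of_bounded (M := C) (by simp)
    (hm.mul (measurable_haarFn q)).aestronglyMeasurable (.of_forall fun t => ?_)
  rw [Real.norm_eq_abs, abs_mul]
  exact (mul_le_of_le_one_right (abs_nonneg _) (abs_haarFn_le q t)).trans (hC t)

lemma haarCoeff_add {f g : ℝ → ℝ} (hf : f ∈ haarSpan) (hg : g ∈ haarSpan) (q : ℕ × ℕ) :
    haarCoeff (f + g) q = haarCoeff f q + haarCoeff g q := by
  simp only [haarCoeff, ip, Pi.add_apply, add_mul]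
  exact integral_add (integrableOn_mul_haarFn hf q) (integrableOn_mul_haarFn hg q)

lemma haarCoeff_smul (a : ℝ) (f : ℝ → ℝ) (q : ℕ × ℕ) :
    haarCoeff (a • f) q = a * haarCoeff f q := by
  simp only [haarCoeff, ip, Pi.smul_apply, smul_eq_mul, mul_assoc]
  exact integral_const_mul _ _

lemma haarCoeff_zero (q : ℕ × ℕ) : haarCoeff 0 q = 0 := by simp [haarCoeff, ip]

lemma haarCoeff_sum {ι : Type*} (s : Finset ι) {x : ι → ℝ → ℝ}
    (hx : ∀ i, x i ∈ haarSpan) (q : ℕ × ℕ) :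
    haarCoeff (∑ i ∈ s, x i) q = ∑ i ∈ s, haarCoeff (x i) q := by
  classical
  induction s using Finset.induction_on with
  | empty => simp [haarCoeff_zero]
  | insert i s hi ih =>
    rw [Finset.sum_insert hi, Finset.sum_insert hi,
      haarCoeff_add (hx i) (sum_mem fun j _ => hx j), ih]

lemma finite_setOf_isDyadic_le (N : ℕ) : {q : Didx | q.1.1 ≤ N}.Finite := by
  refine Set.Finite.of_finite_image (f := Subtype.val)
    (((Set.finite_Iic N).prod (Set.finite_Iic (2 ^ N))).subset ?_) Subtype.val_injective.injOn
  rintro _ ⟨q, hq, rfl⟩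
  have h : q.1.2 < 2 ^ q.1.1 := q.2
  exact ⟨hq, h.le.trans (Nat.pow_le_pow_right two_pos hq)⟩

lemma finite_haarCoeff_support {f : ℝ → ℝ} (hf : f ∈ haarSpan) :
    {q : Didx | haarCoeff f q.1 ≠ 0}.Finite := by
  induction hf using Submodule.span_induction with
  | mem f hf =>
    obtain ⟨p, -, rfl⟩ := hf
    refine (finite_setOf_isDyadic_le p.1).subset fun q hq => ?_
    by_contra h
    exact hq (haarCoeff_haarFn_of_lt q.2 (not_le.1 h))
  | zero => simp [haarCoeff_zero]
  | add f g hf' hg' hf hg =>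
    refine (hf.union hg).subset fun q hq => ?_
    by_contra h
    simp only [Set.mem_union, Set.mem_ofPred_eq, not_or, not_not] at h
    exact hq (by rw [haarCoeff_add hf' hg', h.1, h.2, add_zero])
  | smul a f _ hf =>
    refine hf.subset fun q hq h => hq ?_
    rw [haarCoeff_smul, h, mul_zero]

lemma summable_sqFn {f : ℝ → ℝ} (hf : f ∈ haarSpan) (t : ℝ) :
    Summable fun q : Didx =>
      (haarCoeff f q.1 * 2 ^ q.1.1) ^ 2 * (dint q.1).indicator (fun _ => (1 : ℝ)) t :=
  summable_of_hasFiniteSupport ((finite_haarCoeff_support hf).subset fun q hq h =>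
    hq (by simp [h]))

lemma sqFn_nonneg (f : ℝ → ℝ) (t : ℝ) : 0 ≤ sqFn f t := Real.sqrt_nonneg _

lemma sq_sqFn (f : ℝ → ℝ) (t : ℝ) :
    sqFn f t ^ 2 = ∑' q : Didx,
      (haarCoeff f q.1 * 2 ^ q.1.1) ^ 2 * (dint q.1).indicator (fun _ => (1 : ℝ)) t :=
  Real.sq_sqrt (tsum_nonneg fun _ =>
    mul_nonneg (sq_nonneg _) (Set.indicator_nonneg (fun _ _ => zero_le_one) _))

lemma integrableOn_sqFn {f : ℝ → ℝ} (hf : f ∈ haarSpan) :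
    IntegrableOn (sqFn f) (Set.Ico 0 1) := by
  set s := (finite_haarCoeff_support hf).toFinset
  have h : sqFn f = fun t => Real.sqrt (∑ q ∈ s,
      (haarCoeff f q.1 * 2 ^ q.1.1) ^ 2 * (dint q.1).indicator (fun _ => (1 : ℝ)) t) := by
    funext t
    rw [sqFn, tsum_eq_sum (s := s) fun q hq => ?_]
    have : haarCoeff f q.1 = 0 := by simpa [s] using hq
    simp [this]
  refine Measure.integrableOn_of_bounded
    (M := Real.sqrt (∑ q ∈ s, (haarCoeff f q.1 * 2 ^ q.1.1) ^ 2)) (by simp) ?_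
    (.of_forall fun t => ?_)
  · rw [h]
    exact (Finset.measurable_fun_sum s fun q _ => (measurable_const.indicator
      (measurableSet_dint q.1)).const_mul _).sqrt.aestronglyMeasurable
  · rw [Real.norm_of_nonneg (sqFn_nonneg f t), h]
    refine Real.sqrt_le_sqrt (Finset.sum_le_sum fun q _ => mul_le_of_le_one_right
      (sq_nonneg _) (Set.indicator_le_self' (fun _ _ => zero_le_one) t))

lemma sq_sqFn_sum {ι : Type*} [Fintype ι] {x : ι → ℝ → ℝ} (hx : ∀ i, x i ∈ haarSpan)
    (hdisj : ∀ i j, i ≠ j → Disjoint {q : ℕ × ℕ | IsDyadic q ∧ haarCoeff (x i) q ≠ 0}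
      {q : ℕ × ℕ | IsDyadic q ∧ haarCoeff (x j) q ≠ 0}) (t : ℝ) :
    sqFn (∑ i, x i) t ^ 2 = ∑ i, sqFn (x i) t ^ 2 := by
  have h (q : Didx) : haarCoeff (∑ i, x i) q.1 ^ 2 = ∑ i, haarCoeff (x i) q.1 ^ 2 := by
    rw [haarCoeff_sum _ hx, sq, Finset.sum_mul_sum]
    refine Finset.sum_congr rfl fun i _ => ?_
    rw [sq]
    refine Finset.sum_eq_single i (fun j _ hji => ?_) (by simp)
    by_contra hne
    obtain ⟨hi, hj⟩ := mul_ne_zero_iff.1 hne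
    exact Set.disjoint_left.1 (hdisj j i hji) ⟨q.2, hj⟩ ⟨q.2, hi⟩
  simp only [sq_sqFn]
  rw [← Summable.tsum_finsetSum fun i _ => summable_sqFn (hx i) t]
  simp only [mul_pow, h, Finset.sum_mul]

lemma sum_sqFn_le {ι : Type*} [Fintype ι] {x : ι → ℝ → ℝ} (hx : ∀ i, x i ∈ haarSpan)
    (hdisj : ∀ i j, i ≠ j → Disjoint {q : ℕ × ℕ | IsDyadic q ∧ haarCoeff (x i) q ≠ 0}
      {q : ℕ × ℕ | IsDyadic q ∧ haarCoeff (x j) q ≠ 0}) (t : ℝ) :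
    ∑ i, sqFn (x i) t ≤ Real.sqrt (Fintype.card ι) * sqFn (∑ i, x i) t := by
  refine (sq_le_sq₀ (Finset.sum_nonneg fun i _ => sqFn_nonneg _ _)
    (mul_nonneg (Real.sqrt_nonneg _) (sqFn_nonneg _ _))).1 ?_
  rw [mul_pow, Real.sq_sqrt (Nat.cast_nonneg _), sq_sqFn_sum hx hdisj]
  exact sq_sum_le_card_mul_sum_sq

lemma sum_H1norm_le {ι : Type*} [Fintype ι] {x : ι → ℝ → ℝ} (hx : ∀ i, x i ∈ haarSpan)
    (hdisj : ∀ i j, i ≠ j → Disjoint {q : ℕ × ℕ | IsDyadic q ∧ haarCoeff (x i) q ≠ 0}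
      {q : ℕ × ℕ | IsDyadic q ∧ haarCoeff (x j) q ≠ 0}) :
    ∑ i, H1norm (x i) ≤ Real.sqrt (Fintype.card ι) * H1norm (∑ i, x i) := by
  simp only [H1norm]
  rw [← integral_finsetSum _ fun i _ => integrableOn_sqFn (hx i), ← integral_const_mul]
  exact integral_mono (integrable_finsetSum _ fun i _ => integrableOn_sqFn (hx i))
    ((integrableOn_sqFn (sum_mem fun i _ => hx i)).const_mul _) (sum_sqFn_le hx hdisj)

end DyadicH

/-- If `x = ∑_{ℓ} x_ℓ` with the `x_ℓ` in the span of the Haar system, having pairwise disjoint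
Haar supports, and `‖x_ℓ‖_{H¹} ≥ τ ‖x‖_{H¹} > 0` for every `ℓ`, then `L ≤ 16 τ⁻²`. -/
theorem card_disjoint_blocks_le (τ : ℝ) (hτ : 0 < τ) (L : ℕ) (x : Fin L → (ℝ → ℝ))
    (hx : ∀ ℓ, x ℓ ∈ DyadicH.haarSpan)
    (hdisj : ∀ ℓ ℓ' : Fin L, ℓ ≠ ℓ' →
      Disjoint {q : ℕ × ℕ | DyadicH.IsDyadic q ∧ DyadicH.haarCoeff (x ℓ) q ≠ 0}
        {q : ℕ × ℕ | DyadicH.IsDyadic q ∧ DyadicH.haarCoeff (x ℓ') q ≠ 0})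
    (hpos : 0 < τ * DyadicH.H1norm (∑ ℓ, x ℓ))
    (hlow : ∀ ℓ : Fin L, τ * DyadicH.H1norm (∑ ℓ', x ℓ') ≤ DyadicH.H1norm (x ℓ)) :
    (L : ℝ) ≤ 16 * τ⁻¹ ^ 2 := by
  have hH : 0 < DyadicH.H1norm (∑ ℓ, x ℓ) := pos_of_mul_pos_right hpos hτ.le
  have hsum := DyadicH.sum_H1norm_le hx hdisj
  rw [Fintype.card_fin] at hsum
  have hle : L * (τ * DyadicH.H1norm (∑ ℓ, x ℓ)) ≤ √L * DyadicH.H1norm (∑ ℓ, x ℓ) := by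
    refine le_trans ?_ hsum
    simpa using Finset.card_nsmul_le_sum Finset.univ _ _ fun ℓ _ => hlow ℓ
  have hLτ : L * τ ≤ √L := by
    rw [← mul_assoc] at hle
    exact le_of_mul_le_mul_right hle hH
  have hbound : (L : ℝ) ≤ τ⁻¹ ^ 2 := by
    rcases Nat.eq_zero_or_pos L with rfl | hL
    · simpa using sq_nonneg τ
    have hL' : (0 : ℝ) < √L := Real.sqrt_pos.2 (by exact_mod_cast hL)
    have hsq : √(L : ℝ) * √L = L := Real.mul_self_sqrt (Nat.cast_nonneg _)
    have h : √L * τ ≤ 1 := by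
      refine le_of_mul_le_mul_left ?_ hL'
      rwa [← mul_assoc, hsq, mul_one]
    rw [← hsq, ← sq]
    gcongr
    rwa [← one_div, le_div_iff₀ hτ]
  linarith [sq_nonneg τ⁻¹]

end
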